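/- arXiv:0806.0281 — 2 statements merged into one kernel-verified Lean document; each statement's English description precedes it below -/
import Mathlib

section
/- Let k ≥ 1, k ≤ l ≤ s−1 and s ≤ n. The number of k-flaw preference sets α of length n (with n spaces), entries at most s, first entry l and largest empty space m_α < l equals Σ_{i=k−1}^{l−2} C(n−1, i+1−k) · p_{i+1−k, i; ≤ i} · p^{l−i−1}_{n+k−i−1; ≤ s−i−1}, where C(a,b) is the binomial coefficient. -/
/-- One parking step: a car with preference `a` parks in the first unoccupied
space `j` with `a ≤ j ≤ m`, if such a space exists; otherwise it leaves. -/
def parkStep (m : ℕ) (occ : Finset ℕ) (a : ℕ) : Finset ℕ :=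
  if h : ((Finset.Icc a m) \ occ).Nonempty then
    insert (((Finset.Icc a m) \ occ).min' h) occ
  else occ

/-- The set of occupied spaces after the cars with preference list `l`
(in order of arrival) have tried to park among spaces `1, …, m`. -/
def occupied (m : ℕ) (l : List ℕ) : Finset ℕ := l.foldl (parkStep m) ∅

/-- The number of cars that leave unparked. -/
def flaws (m : ℕ) (l : List ℕ) : ℕ := l.length - (occupied m l).card

/-- The preference list (with entries in `[1, s]`) encoded by a function `Fin n → Fin s`. -/
def prefList {n s : ℕ} (f : Fin n → Fin s) : List ℕ :=
  (List.ofFn f).map (fun i => (i : ℕ) + 1)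

/-- `p n m s k` is the number of `k`-flaw preference sets of length `n` with `m`
parking spaces, all of whose entries are at most `s`. -/
def p (n m s k : ℕ) : ℕ :=
  (Finset.univ.filter (fun f : Fin n → Fin s => flaws m (prefList f) = k)).card

/-- `pL n m s k l` is the number of `k`-flaw preference sets of length `n` with `m`
parking spaces, entries at most `s`, and first entry `l`. -/
def pL (n m s k l : ℕ) : ℕ :=
  (Finset.univ.filter (fun f : Fin n → Fin s =>
    flaws m (prefList f) = k ∧ (prefList f).head? = some l)).card

/-- The set of empty spaces. -/
def empties (m : ℕ) (l : List ℕ) : Finset ℕ := Finset.Icc 1 m \ occupied m l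

/-- `n_α`: the number of entries equal to the first entry. -/
def nstat (l : List ℕ) : ℕ := l.count l.headI

/-- `h_α`: the number of empty spaces smaller than the first entry. -/
def hstat (m : ℕ) (l : List ℕ) : ℕ := ((empties m l).filter (fun x => x < l.headI)).card

/-- `τ_α`: the number of entries smaller than the first entry, plus one. -/
def taustat (l : List ℕ) : ℕ := l.countP (fun a => a < l.headI) + 1

/-- `m_α`: the largest empty space. -/
def mstat (m : ℕ) (l : List ℕ) : ℕ := (empties m l).sup id

theorem mem_parkStep (m : ℕ) (O : Finset ℕ) (a x : ℕ) :
    x ∈ parkStep m O a ↔ x ∈ O ∨ (a ≤ x ∧ x ≤ m ∧ x ∉ O ∧ ∀ y, a ≤ y → y < x → y ∈ O) := by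
  unfold parkStep
  split_ifs with h
  · rw [Finset.mem_insert]
    have h1 := Finset.min'_mem _ h
    have h2 : ∀ y ∈ Finset.Icc a m \ O, (Finset.Icc a m \ O).min' h ≤ y :=
      fun y hy => Finset.min'_le (Finset.Icc a m \ O) y hy
    generalize (Finset.Icc a m \ O).min' h = z at *
    simp only [Finset.mem_sdiff, Finset.mem_Icc] at h1 h2
    constructor
    · rintro (rfl | hx)
      · right
        refine ⟨h1.1.1, h1.1.2, h1.2, fun y hy hyx => ?_⟩
        by_contra hc
        have := h2 y ⟨⟨hy, by omega⟩, hc⟩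
        omega
      · exact Or.inl hx
    · rintro (hx | ⟨h3, h4, h5, h6⟩)
      · exact Or.inr hx
      · left
        have := h2 x ⟨⟨h3, h4⟩, h5⟩
        by_contra hne
        exact h1.2 (h6 z h1.1.1 (by omega))
  · constructor
    · exact Or.inl
    · rintro (hx | ⟨h3, h4, h5, h6⟩)
      · exact hx
      · exact absurd ⟨x, by simp [h3, h4, h5]⟩ h

theorem card_parkStep_of_exists (m : ℕ) (O : Finset ℕ) (a : ℕ)
    (h : ∃ y, a ≤ y ∧ y ≤ m ∧ y ∉ O) : (parkStep m O a).card = O.card + 1 := by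
  obtain ⟨y, h1, h2, h3⟩ := h
  have hne : (Finset.Icc a m \ O).Nonempty := ⟨y, by simp [h1, h2, h3]⟩
  unfold parkStep
  rw [dif_pos hne, Finset.card_insert_of_notMem]
  have := Finset.min'_mem _ hne
  exact (Finset.mem_sdiff.1 this).2

theorem parkStep_of_not_exists (m : ℕ) (O : Finset ℕ) (a : ℕ)
    (h : ¬ ∃ y, a ≤ y ∧ y ≤ m ∧ y ∉ O) : parkStep m O a = O := by
  unfold parkStep
  rw [dif_neg]
  rintro ⟨y, hy⟩
  simp only [Finset.mem_sdiff, Finset.mem_Icc] at hy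
  exact h ⟨y, hy.1.1, hy.1.2, hy.2⟩

theorem occupied_snoc (m : ℕ) (L : List ℕ) (a : ℕ) :
    occupied m (L ++ [a]) = parkStep m (occupied m L) a := by
  simp [occupied]

theorem occupied_nil (m : ℕ) : occupied m [] = ∅ := rfl

theorem occupied_le (m : ℕ) (L : List ℕ) : ∀ x ∈ occupied m L, x ≤ m := by
  induction L using List.reverseRecOn with
  | nil => simp [occupied_nil]
  | append_singleton L a ih =>
    intro x hx
    rw [occupied_snoc, mem_parkStep] at hx
    rcases hx with hx | hx
    · exact ih x hx
    · exact hx.2.1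

theorem occupied_pos (m : ℕ) (L : List ℕ) (hL : ∀ a ∈ L, 1 ≤ a) :
    ∀ x ∈ occupied m L, 1 ≤ x := by
  induction L using List.reverseRecOn with
  | nil => simp [occupied_nil]
  | append_singleton L a ih =>
    intro x hx
    rw [occupied_snoc, mem_parkStep] at hx
    rcases hx with hx | hx
    · exact ih (fun b hb => hL b (by simp [hb])) x hx
    · exact (hL a (by simp)).trans hx.1

theorem occupied_subset (m : ℕ) (L : List ℕ) (hL : ∀ a ∈ L, 1 ≤ a) :
    occupied m L ⊆ Finset.Icc 1 m := fun x hx =>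
  Finset.mem_Icc.2 ⟨occupied_pos m L hL x hx, occupied_le m L x hx⟩

theorem card_occupied_le (m : ℕ) (L : List ℕ) : (occupied m L).card ≤ L.length := by
  induction L using List.reverseRecOn with
  | nil => simp [occupied_nil]
  | append_singleton L a ih =>
    rw [occupied_snoc]
    by_cases h : ∃ y, a ≤ y ∧ y ≤ m ∧ y ∉ occupied m L
    · rw [card_parkStep_of_exists _ _ _ h]; simpa using ih
    · rw [parkStep_of_not_exists _ _ _ h]; simp; omega

theorem flaws_zero_iff (m : ℕ) (L : List ℕ) :
    flaws m L = 0 ↔ (occupied m L).card = L.length := by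
  have := card_occupied_le m L
  unfold flaws; omega

theorem flaws_snoc_zero (m : ℕ) (L : List ℕ) (a : ℕ) :
    flaws m (L ++ [a]) = 0 ↔ flaws m L = 0 ∧ ∃ y, a ≤ y ∧ y ≤ m ∧ y ∉ occupied m L := by
  rw [flaws_zero_iff, flaws_zero_iff, occupied_snoc]
  have := card_occupied_le m L
  by_cases h : ∃ y, a ≤ y ∧ y ≤ m ∧ y ∉ occupied m L
  · rw [card_parkStep_of_exists _ _ _ h]; simp [h]
  · rw [parkStep_of_not_exists _ _ _ h]; simp [h]; omega

/-- the part of the list below `c` -/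
def lowPart (c : ℕ) (L : List ℕ) : List ℕ := L.filter (fun a => a < c)

/-- the part of the list above `c`, shifted -/
def highPart (c : ℕ) (L : List ℕ) : List ℕ := (L.filter (fun a => c < a)).map (fun a => a - c)

/-- the decomposition of the occupied set at `c` -/
def SplitAt (m c : ℕ) (L : List ℕ) : Prop :=
  ∀ x, x ∈ occupied m L ↔ x ∈ occupied (c - 1) (lowPart c L) ∨
    (c < x ∧ x - c ∈ occupied (m - c) (highPart c L))

theorem highPart_pos (c : ℕ) (L : List ℕ) : ∀ a ∈ highPart c L, 1 ≤ a := by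
  intro a ha
  simp only [highPart, List.mem_map, List.mem_filter, decide_eq_true_eq] at ha
  obtain ⟨b, ⟨_, h⟩, rfl⟩ := ha
  omega

theorem split_not_mem (m c : ℕ) (hc : 1 ≤ c) (L : List ℕ) (h : SplitAt m c L) :
    c ∉ occupied m L := by
  rw [h c]
  rintro (h1 | h1)
  · have := occupied_le _ _ _ h1; omega
  · omega

theorem lowPart_snoc_lt (c : ℕ) (L : List ℕ) (a : ℕ) (h : a < c) :
    lowPart c (L ++ [a]) = lowPart c L ++ [a] := by simp [lowPart, h]

theorem lowPart_snoc_ge (c : ℕ) (L : List ℕ) (a : ℕ) (h : ¬ a < c) :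
    lowPart c (L ++ [a]) = lowPart c L := by
  simp only [lowPart, List.filter_append]; simp [List.filter_cons, h]

theorem highPart_snoc_gt (c : ℕ) (L : List ℕ) (a : ℕ) (h : c < a) :
    highPart c (L ++ [a]) = highPart c L ++ [a - c] := by simp [highPart, h]

theorem highPart_snoc_le (c : ℕ) (L : List ℕ) (a : ℕ) (h : ¬ c < a) :
    highPart c (L ++ [a]) = highPart c L := by
  simp only [highPart, List.filter_append]; simp [List.filter_cons, h]

theorem split_of (m c : ℕ) (hc : 1 ≤ c) (hcm : c ≤ m) (L : List ℕ)
    (h1 : c ∉ L) (h2 : flaws (c - 1) (lowPart c L) = 0) : SplitAt m c L := by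
  induction L using List.reverseRecOn with
  | nil => intro x; simp [lowPart, highPart, occupied_nil]
  | append_singleton L a ih =>
    simp only [List.mem_append, List.mem_singleton, not_or] at h1
    rcases Nat.lt_trichotomy a c with hac | hac | hac
    · rw [lowPart_snoc_lt _ _ _ hac, flaws_snoc_zero] at h2
      have ih := ih h1.1 h2.1
      obtain ⟨y, hy1, hy2, hy3⟩ := h2.2
      have key : ∀ z, z < c → (z ∈ occupied m L ↔ z ∈ occupied (c - 1) (lowPart c L)) := by
        intro z hz
        rw [ih z]
        exact ⟨fun h => h.elim id (fun h => by omega), Or.inl⟩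
      intro x
      rw [lowPart_snoc_lt _ _ _ hac, highPart_snoc_le _ _ _ (by omega), occupied_snoc,
        occupied_snoc, mem_parkStep, mem_parkStep]
      by_cases hx : x < c
      · rw [key x hx]
        constructor
        · rintro (h | ⟨h3, h4, h5, h6⟩)
          · exact Or.inl (Or.inl h)
          · exact Or.inl (Or.inr ⟨h3, by omega, h5, fun z hz hzx =>
              (key z (by omega)).1 (h6 z hz hzx)⟩)
        · rintro ((h | ⟨h3, h4, h5, h6⟩) | h)
          · exact Or.inl h
          · exact Or.inr ⟨h3, by omega, h5, fun z hz hzx =>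
              (key z (by omega)).2 (h6 z hz hzx)⟩
          · omega
      · rw [ih x]
        constructor
        · rintro ((h | h) | ⟨h3, h4, h5, h6⟩)
          · exact Or.inl (Or.inl h)
          · exact Or.inr h
          · exact absurd ((key y (by omega)).1 (h6 y hy1 (by omega))) hy3
        · rintro ((h | ⟨h3, h4, h5, h6⟩) | h)
          · exact Or.inl (Or.inl h)
          · omega
          · exact Or.inl (Or.inr h)
    · exact absurd hac.symm h1.2
    · rw [lowPart_snoc_ge _ _ _ (by omega)] at h2
      have ih := ih h1.1 h2
      have key : ∀ z, c < z → (z ∈ occupied m L ↔ z - c ∈ occupied (m - c) (highPart c L)) := by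
        intro z hz
        rw [ih z]
        constructor
        · rintro (h | h)
          · have := occupied_le _ _ _ h; omega
          · exact h.2
        · exact fun h => Or.inr ⟨hz, h⟩
      intro x
      rw [lowPart_snoc_ge _ _ _ (by omega), highPart_snoc_gt _ _ _ hac, occupied_snoc,
        occupied_snoc, mem_parkStep, mem_parkStep]
      by_cases hx : c < x
      · rw [key x hx]
        constructor
        · rintro (h | ⟨h3, h4, h5, h6⟩)
          · exact Or.inr ⟨hx, Or.inl h⟩
          · refine Or.inr ⟨hx, Or.inr ⟨by omega, by omega, h5, fun z hz hzx => ?_⟩⟩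
            have := (key (z + c) (by omega)).1 (h6 (z + c) (by omega) (by omega))
            simpa using this
        · rintro (h | ⟨h3, h | ⟨h4, h5, h6, h7⟩⟩)
          · have := occupied_le _ _ _ h; omega
          · exact Or.inl h
          · exact Or.inr ⟨by omega, by omega, h6, fun z hz hzx =>
              (key z (by omega)).2 (h7 (z - c) (by omega) (by omega))⟩
      · rw [ih x]
        constructor
        · rintro ((h | h) | h)
          · exact Or.inl h
          · omega
          · omega
        · rintro (h | h)
          · exact Or.inl (Or.inl h)
          · omega

theorem of_not_mem (m c : ℕ) (hc : 1 ≤ c) (hcm : c ≤ m) (L : List ℕ)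
    (h : c ∉ occupied m L) : c ∉ L ∧ flaws (c - 1) (lowPart c L) = 0 := by
  induction L using List.reverseRecOn with
  | nil => simp [lowPart, flaws]
  | append_singleton L a ih =>
    rw [occupied_snoc, mem_parkStep, not_or] at h
    obtain ⟨hL, hs⟩ := ih h.1
    have hsp := split_of m c hc hcm L hL hs
    rcases Nat.lt_trichotomy a c with hac | hac | hac
    · refine ⟨by simp [hL]; omega, ?_⟩
      rw [lowPart_snoc_lt _ _ _ hac, flaws_snoc_zero]
      refine ⟨hs, ?_⟩
      by_contra hcon
      push Not at hcon
      exact h.2 ⟨hac.le, hcm, h.1, fun y hy hyc => (hsp y).2 (Or.inl (hcon y hy (by omega)))⟩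
    · exact absurd ⟨by omega, hcm, h.1, fun y hy hyc => by omega⟩ h.2
    · refine ⟨by simp [hL]; omega, ?_⟩
      rwa [lowPart_snoc_ge _ _ _ (by omega)]

theorem occupied_trunc (M k : ℕ) (L : List ℕ) (x : ℕ) (hx : x ≤ M) :
    x ∈ occupied M L ↔ x ∈ occupied (M + k) L := by
  induction L using List.reverseRecOn generalizing x with
  | nil => simp [occupied_nil]
  | append_singleton L a ih =>
    rw [occupied_snoc, occupied_snoc, mem_parkStep, mem_parkStep, ih x hx]
    constructor
    · rintro (h | ⟨h1, h2, h3, h4⟩)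
      · exact Or.inl h
      · exact Or.inr ⟨h1, by omega, h3, fun y hy hyx => (ih y (by omega)).1 (h4 y hy hyx)⟩
    · rintro (h | ⟨h1, h2, h3, h4⟩)
      · exact Or.inl h
      · exact Or.inr ⟨h1, by omega, h3, fun y hy hyx => (ih y (by omega)).2 (h4 y hy hyx)⟩

theorem full_iff (M k : ℕ) (L : List ℕ) (hL : ∀ a ∈ L, 1 ≤ a ∧ a ≤ M) (hlen : L.length = M + k) :
    (∀ x, 1 ≤ x → x ≤ M → x ∈ occupied M L) ↔ flaws (M + k) L = 0 := by
  have hsub := occupied_subset (M + k) L (fun a ha => (hL a ha).1)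
  constructor
  · intro h
    have : occupied (M + k) L = Finset.Icc 1 (M + k) := by
      refine Finset.Subset.antisymm hsub fun j hj => ?_
      rw [Finset.mem_Icc] at hj
      by_cases hjM : j ≤ M
      · exact (occupied_trunc M k L j hjM).1 (h j hj.1 hjM)
      · by_contra hcon
        have h2 := (of_not_mem (M + k) j hj.1 hj.2 L hcon).2
        have h3 : lowPart j L = L := by
          unfold lowPart
          rw [List.filter_eq_self]
          intro a ha
          have := hL a ha
          simp; omega
        rw [h3, flaws_zero_iff] at h2
        have h4 := Finset.card_le_card (occupied_subset (j - 1) L (fun a ha => (hL a ha).1))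
        simp at h4
        omega
    rw [flaws_zero_iff, this, hlen]; simp
  · intro h x hx hxM
    rw [occupied_trunc M k L x hxM]
    rw [flaws_zero_iff, hlen] at h
    rw [Finset.eq_of_subset_of_card_le hsub (by simp [h])]
    simp; omega

/-- weighted sum over all lists of length `n` with entries in `[1, s]` -/
def wsum (s : ℕ) : ℕ → (List ℕ → ℕ) → ℕ
  | 0, w => w []
  | n + 1, w => ∑ x ∈ Finset.Icc 1 s, wsum s n (fun T => w (x :: T))

theorem wsum_congr (s n : ℕ) (w v : List ℕ → ℕ)
    (h : ∀ T : List ℕ, T.length = n → (∀ a ∈ T, 1 ≤ a ∧ a ≤ s) → w T = v T) :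
    wsum s n w = wsum s n v := by
  induction n generalizing w v with
  | zero => exact h [] rfl (by simp)
  | succ n ih =>
    refine Finset.sum_congr rfl fun x hx => ih _ _ fun T hT hT2 => h _ (by simp [hT]) ?_
    rw [Finset.mem_Icc] at hx
    intro a ha
    rcases List.mem_cons.1 ha with rfl | ha
    · exact hx
    · exact hT2 a ha

theorem wsum_zero (s n : ℕ) : wsum s n (fun _ => 0) = 0 := by
  induction n with
  | zero => rfl
  | succ n ih => simp [wsum, ih]

theorem wsum_sum (s n : ℕ) (I : Finset ℕ) (w : ℕ → List ℕ → ℕ) :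
    wsum s n (fun T => ∑ i ∈ I, w i T) = ∑ i ∈ I, wsum s n (w i) := by
  induction n generalizing w with
  | zero => rfl
  | succ n ih =>
    simp only [wsum]
    rw [Finset.sum_comm]
    exact Finset.sum_congr rfl fun x _ => ih _

theorem prefList_cons {n s : ℕ} (x : Fin s) (f : Fin n → Fin s) :
    prefList (Fin.cons x f : Fin (n + 1) → Fin s) = ((x : ℕ) + 1) :: prefList f := by
  simp [prefList, List.ofFn_succ]

theorem sum_eq_wsum (s n : ℕ) (w : List ℕ → ℕ) :
    ∑ f : Fin n → Fin s, w (prefList f) = wsum s n w := by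
  induction n generalizing w with
  | zero => simp [wsum, prefList]
  | succ n ih =>
    rw [← (Fin.consEquiv (fun _ : Fin (n + 1) => Fin s)).sum_comp, Fintype.sum_prod_type]
    simp only [Fin.consEquiv, Equiv.coe_fn_mk, prefList_cons, wsum]
    rw [Finset.sum_congr rfl fun x _ => ih (fun T => w ((((x : Fin s) : ℕ) + 1) :: T))]
    rw [Fin.sum_univ_eq_sum_range (fun x => wsum s n (fun T => w ((x + 1) :: T)))]
    rw [Finset.range_eq_Ico, Finset.sum_Ico_add' (fun x => wsum s n (fun T => w (x :: T)))]
    rfl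

theorem card_eq_wsum (s n : ℕ) (P : List ℕ → Prop) [DecidablePred P] :
    (Finset.univ.filter (fun f : Fin n → Fin s => P (prefList f))).card =
      wsum s n (fun T => if P T then 1 else 0) := by
  rw [Finset.card_filter, ← sum_eq_wsum]

theorem wsum_mul (s n a : ℕ) (w : List ℕ → ℕ) :
    wsum s n (fun T => a * w T) = a * wsum s n w := by
  induction n generalizing w with
  | zero => rfl
  | succ n ih => simp only [wsum, ih, Finset.mul_sum]

theorem wsum_shuffle (c d n r : ℕ) (u v : List ℕ → ℕ) :
    wsum (c + 1 + d) n (fun T => if c + 1 ∉ T ∧ (lowPart (c + 1) T).length = r then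
      u (lowPart (c + 1) T) * v (highPart (c + 1) T) else 0) =
    n.choose r * wsum c r u * wsum d (n - r) v := by
  induction n generalizing r u v with
  | zero =>
    cases r with
    | zero => simp [wsum, lowPart, highPart]
    | succ r => simp [wsum, lowPart]
  | succ n ih =>
    have hI : Finset.Icc 1 (c + 1 + d) =
        Finset.Icc 1 c ∪ ({c + 1} ∪ (Finset.Icc 1 d).image (fun y => y + (c + 1))) := by
      ext x
      simp only [Finset.mem_Icc, Finset.mem_union, Finset.mem_singleton, Finset.mem_image]
      constructor
      · intro h
        by_cases h1 : x ≤ c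
        · left; omega
        · right
          by_cases h2 : x = c + 1
          · left; exact h2
          · right; exact ⟨x - (c + 1), by omega, by omega⟩
      · rintro (h | h | ⟨y, h, rfl⟩) <;> omega
    have e1 : ∑ x ∈ Finset.Icc 1 c, wsum (c + 1 + d) n (fun T =>
        if c + 1 ∉ x :: T ∧ (lowPart (c + 1) (x :: T)).length = r then
        u (lowPart (c + 1) (x :: T)) * v (highPart (c + 1) (x :: T)) else 0) =
        (if r = 0 then 0 else n.choose (r - 1)) * wsum c r u * wsum d (n + 1 - r) v := by
      cases r with
      | zero =>
        simp only [if_true, zero_mul]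
        refine Finset.sum_eq_zero fun x hx => ?_
        rw [Finset.mem_Icc] at hx
        refine (wsum_congr _ _ _ (fun _ => 0) fun T _ _ => ?_).trans (wsum_zero _ _)
        rw [if_neg]
        simp [lowPart, show x ≤ c by omega]
      | succ r =>
        simp only [Nat.succ_ne_zero, if_false, Nat.add_sub_cancel, Nat.add_sub_add_right, wsum]
        rw [Finset.mul_sum, Finset.sum_mul]
        refine Finset.sum_congr rfl fun x hx => ?_
        rw [Finset.mem_Icc] at hx
        rw [← ih]
        congr 1
        funext T
        have a1 : lowPart (c + 1) (x :: T) = x :: lowPart (c + 1) T := by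
          simp [lowPart, List.filter_cons, show x ≤ c by omega]
        have a2 : highPart (c + 1) (x :: T) = highPart (c + 1) T := by
          simp [highPart, List.filter_cons, show ¬ c + 1 < x by omega]
        have a3 : c + 1 ∉ x :: T ↔ c + 1 ∉ T := by
          simp; omega
        simp only [a1, a2, a3, List.length_cons, Nat.add_right_cancel_iff]
    have e2 : wsum (c + 1 + d) n (fun T =>
        if c + 1 ∉ (c + 1) :: T ∧ (lowPart (c + 1) ((c + 1) :: T)).length = r then
        u (lowPart (c + 1) ((c + 1) :: T)) * v (highPart (c + 1) ((c + 1) :: T)) else 0) = 0 := by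
      simp [wsum_zero]
    have e3 : ∑ y ∈ Finset.Icc 1 d, wsum (c + 1 + d) n (fun T =>
        if c + 1 ∉ (y + (c + 1)) :: T ∧ (lowPart (c + 1) ((y + (c + 1)) :: T)).length = r then
        u (lowPart (c + 1) ((y + (c + 1)) :: T)) *
          v (highPart (c + 1) ((y + (c + 1)) :: T)) else 0) =
        n.choose r * wsum c r u * wsum d (n + 1 - r) v := by
      have b : n.choose r * wsum c r u * wsum d (n + 1 - r) v =
          n.choose r * wsum c r u * wsum d (n - r + 1) v := by
        by_cases h : r ≤ n
        · rw [Nat.sub_add_comm h]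
        · rw [Nat.choose_eq_zero_of_lt (by omega)]; simp
      rw [b]
      simp only [wsum]
      rw [Finset.mul_sum]
      refine Finset.sum_congr rfl fun y hy => ?_
      rw [Finset.mem_Icc] at hy
      rw [← ih]
      congr 1
      funext T
      have a1 : lowPart (c + 1) ((y + (c + 1)) :: T) = lowPart (c + 1) T := by
        simp [lowPart, List.filter_cons, show c < y + (c + 1) by omega]
      have a2 : highPart (c + 1) ((y + (c + 1)) :: T) = y :: highPart (c + 1) T := by
        simp [highPart, List.filter_cons, show c + 1 < y + (c + 1) by omega]
      have a3 : c + 1 ∉ (y + (c + 1)) :: T ↔ c + 1 ∉ T := by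
        simp; omega
      simp only [a1, a2, a3]
    simp only [wsum]
    rw [hI, Finset.sum_union, Finset.sum_union, Finset.sum_singleton, Finset.sum_image, e1, e2, e3]
    · cases r with
      | zero => simp
      | succ r =>
        rw [Nat.choose_succ_succ]
        simp only [Nat.succ_ne_zero, if_false, Nat.add_sub_cancel]
        ring
    · intro a _ b _ h; simpa using h
    · rw [Finset.disjoint_left]
      intro x hx hy
      simp only [Finset.mem_Icc, Finset.mem_singleton, Finset.mem_image] at hx hy
      obtain ⟨y, hy, rfl⟩ := hy
      omega
    · rw [Finset.disjoint_left]
      intro x hx hy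
      simp only [Finset.mem_Icc, Finset.mem_singleton, Finset.mem_image, Finset.mem_union] at hx hy
      rcases hy with hy | ⟨y, hy, rfl⟩ <;> omega

theorem wsum_head (s n l : ℕ) (h1 : 1 ≤ l) (h2 : l ≤ s) (P : List ℕ → Prop) [DecidablePred P] :
    wsum s (n + 1) (fun T => if P T ∧ T.head? = some l then 1 else 0) =
      wsum s n (fun T => if P (l :: T) then 1 else 0) := by
  simp only [wsum, List.head?_cons, Option.some.injEq]
  rw [Finset.sum_eq_single l]
  · simp
  · intro b _ hb
    simp only [hb, and_false, if_false, wsum_zero]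
  · intro h; exact absurd (Finset.mem_Icc.2 ⟨h1, h2⟩) h

theorem mstat_mem (n k : ℕ) (L : List ℕ) (hk : 1 ≤ k) (hlen : L.length = n)
    (hf : flaws n L = k) : mstat n L ∈ empties n L := by
  have hne : (empties n L).Nonempty := by
    unfold empties
    rw [Finset.sdiff_nonempty]
    intro hsub
    have := Finset.card_le_card hsub
    simp at this
    unfold flaws at hf
    omega
  obtain ⟨x, hx, hx2⟩ := Finset.exists_mem_eq_sup _ hne id
  unfold mstat
  rw [hx2]
  exact hx

theorem mstat_eq_iff (n c : ℕ) (hc : 1 ≤ c) (hcn : c ≤ n) (L : List ℕ) :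
    mstat n L = c ↔ c ∉ occupied n L ∧ ∀ x, c < x → x ≤ n → x ∈ occupied n L := by
  constructor
  · intro h
    have hne : (empties n L).Nonempty := by
      by_contra hcon
      rw [Finset.not_nonempty_iff_eq_empty] at hcon
      simp [mstat, hcon] at h
      omega
    obtain ⟨x, hx, hx2⟩ := Finset.exists_mem_eq_sup _ hne id
    have hxc : x = c := by rw [← h]; exact hx2.symm
    subst hxc
    refine ⟨(Finset.mem_sdiff.1 hx).2, fun y hy hyn => ?_⟩
    by_contra hcon
    have : id y ≤ (empties n L).sup id :=
      Finset.le_sup (Finset.mem_sdiff.2 ⟨Finset.mem_Icc.2 ⟨by omega, hyn⟩, hcon⟩)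
    rw [hx2] at this
    simp at this
    omega
  · rintro ⟨h1, h2⟩
    refine le_antisymm (Finset.sup_le fun x hx => ?_) ?_
    · simp only [empties, Finset.mem_sdiff, Finset.mem_Icc] at hx
      by_contra hcon
      exact hx.2 (h2 x (by simpa using hcon) hx.1.2)
    · exact Finset.le_sup (f := id) (Finset.mem_sdiff.2 ⟨Finset.mem_Icc.2 ⟨hc, hcn⟩, h1⟩)

theorem length_parts (c : ℕ) (L : List ℕ) (h : c ∉ L) :
    (lowPart c L).length + (highPart c L).length = L.length := by
  induction L with
  | nil => simp [lowPart, highPart]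
  | cons a L ih =>
    simp only [List.mem_cons, not_or] at h
    have ih := ih h.2
    simp only [lowPart, highPart, List.length_map] at ih ⊢
    rcases Nat.lt_or_gt_of_ne h.1 with h1 | h1
    · simp [List.filter_cons, h1, show ¬ a < c by omega]; omega
    · simp [List.filter_cons, h1, show ¬ c < a by omega]; omega

theorem main_iff (n s k c : ℕ) (hk : 1 ≤ k) (hc : 1 ≤ c) (hcn : c ≤ n) (hsn : s ≤ n)
    (L : List ℕ) (hlen : L.length = n) (hL : ∀ a ∈ L, 1 ≤ a ∧ a ≤ s) :
    (flaws n L = k ∧ mstat n L = c) ↔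
      k ≤ c ∧ (c ∉ L ∧ (lowPart c L).length = c - k) ∧ flaws (c - 1) (lowPart c L) = 0 ∧
        flaws (n + k - c) (highPart c L) = 0 := by
  rw [mstat_eq_iff n c hc hcn]
  have hhigh : ∀ a ∈ highPart c L, 1 ≤ a ∧ a ≤ n - c := by
    intro a ha
    simp only [highPart, List.mem_map, List.mem_filter, decide_eq_true_eq] at ha
    obtain ⟨b, ⟨hb, h⟩, rfl⟩ := ha
    have := hL b hb
    omega
  have hlowpos : ∀ a ∈ lowPart c L, 1 ≤ a := fun a ha => (hL a (List.mem_filter.1 ha).1).1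
  -- common computation
  have common : c ∉ L → flaws (c - 1) (lowPart c L) = 0 →
      (∀ x, 1 ≤ x → x ≤ n - c → x ∈ occupied (n - c) (highPart c L)) →
      (occupied n L).card = (lowPart c L).length + (n - c) := by
    intro h1 h2 h3
    have hsp := split_of n c hc hcn L h1 h2
    have : occupied n L = occupied (c - 1) (lowPart c L) ∪ Finset.Icc (c + 1) n := by
      ext x
      rw [hsp x, Finset.mem_union, Finset.mem_Icc]
      refine or_congr Iff.rfl ⟨fun h => ?_, fun h => ⟨by omega, h3 _ (by omega) (by omega)⟩⟩
      have := occupied_le _ _ _ h.2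
      omega
    rw [this, Finset.card_union_of_disjoint, (flaws_zero_iff _ _).1 h2]
    · simp
    · rw [Finset.disjoint_left]
      intro x hx hy
      have := occupied_le _ _ _ hx
      rw [Finset.mem_Icc] at hy
      omega
  constructor
  · rintro ⟨hf, h1, h2⟩
    obtain ⟨h3, h4⟩ := of_not_mem n c hc hcn L h1
    have hsp := split_of n c hc hcn L h3 h4
    have hfull : ∀ x, 1 ≤ x → x ≤ n - c → x ∈ occupied (n - c) (highPart c L) := by
      intro x hx hxn
      have := (hsp (x + c)).1 (h2 (x + c) (by omega) (by omega))
      rcases this with h | h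
      · have := occupied_le _ _ _ h; omega
      · simpa using h.2
    have hcard := common h3 h4 hfull
    have hle := card_occupied_le n L
    have hlow := Finset.card_le_card (occupied_subset (c - 1) (lowPart c L) hlowpos)
    rw [(flaws_zero_iff _ _).1 h4] at hlow
    simp at hlow
    unfold flaws at hf
    have hparts := length_parts c L h3
    have hkc : k ≤ c := by omega
    refine ⟨hkc, ⟨h3, by omega⟩, h4, ?_⟩
    rw [show n + k - c = n - c + k by omega]
    exact (full_iff (n - c) k _ hhigh (by omega)).1 hfull
  · rintro ⟨hkc, ⟨h3, h5⟩, h4, h6⟩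
    have hparts := length_parts c L h3
    rw [show n + k - c = n - c + k by omega] at h6
    have hfull := (full_iff (n - c) k _ hhigh (by omega)).2 h6
    have hcard := common h3 h4 hfull
    have hsp := split_of n c hc hcn L h3 h4
    refine ⟨by unfold flaws; omega, split_not_mem n c hc L hsp, fun x hx hxn => ?_⟩
    exact (hsp x).2 (Or.inr ⟨hx, hfull _ (by omega) (by omega)⟩)

/-- Lemma 6.2: for `k ≥ 1`, `k ≤ l ≤ s-1` and `s ≤ n`, the number of `k`-flaw preference
sets `α` of length `n` (with `n` spaces), entries at most `s`, first entry `l` and largest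
empty space `m_α < l` equals
`Σ_{i=k-1}^{l-2} C(n-1, i+1-k) · p_{i+1-k,i;≤i} · p^{l-i-1}_{n+k-i-1;≤s-i-1}`. -/
theorem stmt15 (n s k l : ℕ) (hk : 1 ≤ k) (hkl : k ≤ l) (hls : l ≤ s - 1) (hsn : s ≤ n) :
    (Finset.univ.filter (fun f : Fin n → Fin s =>
        flaws n (prefList f) = k ∧ (prefList f).head? = some l ∧
        mstat n (prefList f) < l)).card =
      ∑ i ∈ Finset.Ico (k - 1) (l - 1),
        Nat.choose (n - 1) (i + 1 - k) * p (i + 1 - k) i i 0 *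
          pL (n + k - i - 1) (n + k - i - 1) (s - i - 1) 0 (l - i - 1) := by
  obtain ⟨n, rfl⟩ : ∃ n', n = n' + 1 := ⟨n - 1, by omega⟩
  have hl1 : 1 ≤ l := by omega
  have hls' : l ≤ s := by omega
  rw [card_eq_wsum s (n + 1) (fun T => flaws (n + 1) T = k ∧ T.head? = some l ∧
    mstat (n + 1) T < l)]
  have e0 : wsum s (n + 1) (fun T => if flaws (n + 1) T = k ∧ T.head? = some l ∧
      mstat (n + 1) T < l then 1 else 0) =
      wsum s (n + 1) (fun T => if (flaws (n + 1) T = k ∧ mstat (n + 1) T < l) ∧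
        T.head? = some l then 1 else 0) := by
    congr 1
    funext T
    congr 1
    exact propext (by tauto)
  rw [e0, wsum_head s n l hl1 hls' (fun T => flaws (n + 1) T = k ∧ mstat (n + 1) T < l)]
  have e1 : wsum s n (fun T => if flaws (n + 1) (l :: T) = k ∧ mstat (n + 1) (l :: T) < l
      then 1 else 0) =
      wsum s n (fun T => ∑ i ∈ Finset.Ico (k - 1) (l - 1),
        if i + 1 ∉ T ∧ (lowPart (i + 1) T).length = i + 1 - k then
          (if flaws i (lowPart (i + 1) T) = 0 then 1 else 0) *
          (if flaws (n + 1 + k - i - 1) ((l - i - 1) :: highPart (i + 1) T) = 0 then 1 else 0)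
        else 0) := by
    refine wsum_congr _ _ _ _ fun T hlen hT => ?_
    have hT' : ∀ a ∈ l :: T, 1 ≤ a ∧ a ≤ s := by
      intro a ha
      rcases List.mem_cons.1 ha with rfl | ha
      · exact ⟨hl1, hls'⟩
      · exact hT a ha
    have hlen' : (l :: T).length = n + 1 := by simp [hlen]
    have key : ∀ i ∈ Finset.Ico (k - 1) (l - 1),
        (if i + 1 ∉ T ∧ (lowPart (i + 1) T).length = i + 1 - k then
          (if flaws i (lowPart (i + 1) T) = 0 then 1 else 0) *
          (if flaws (n + 1 + k - i - 1) ((l - i - 1) :: highPart (i + 1) T) = 0 then 1 else 0)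
        else 0) =
        if flaws (n + 1) (l :: T) = k ∧ mstat (n + 1) (l :: T) = i + 1 then 1 else 0 := by
      intro i hi
      rw [Finset.mem_Ico] at hi
      have hm := main_iff (n + 1) s k (i + 1) hk (by omega) (by omega) hsn (l :: T) hlen' hT'
      have a1 : lowPart (i + 1) (l :: T) = lowPart (i + 1) T := by
        simp [lowPart, List.filter_cons, show i < l by omega]
      have a2 : highPart (i + 1) (l :: T) = (l - i - 1) :: highPart (i + 1) T := by
        simp [highPart, List.filter_cons, show i + 1 < l by omega, Nat.sub_sub]
      have a3 : i + 1 ∉ l :: T ↔ i + 1 ∉ T := by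
        simp; omega
      rw [a1, a2, a3, show n + 1 + k - (i + 1) = n + 1 + k - i - 1 by omega,
        Nat.add_sub_cancel] at hm
      simp only [hm, show k ≤ i + 1 by omega, true_and]
      split_ifs <;> simp_all
    rw [Finset.sum_congr rfl key]
    by_cases hf : flaws (n + 1) (l :: T) = k
    · have hmem := mstat_mem (n + 1) k (l :: T) hk hlen' hf
      simp only [empties, Finset.mem_sdiff, Finset.mem_Icc] at hmem
      have hmm := (main_iff (n + 1) s k (mstat (n + 1) (l :: T)) hk hmem.1.1 hmem.1.2 hsn
        (l :: T) hlen' hT').1 ⟨hf, rfl⟩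
      by_cases hml : mstat (n + 1) (l :: T) < l
      · rw [if_pos ⟨hf, hml⟩, Finset.sum_eq_single (mstat (n + 1) (l :: T) - 1)]
        · rw [if_pos ⟨hf, by omega⟩]
        · intro b _ hb
          rw [if_neg]
          rintro ⟨_, h⟩
          omega
        · intro h
          rw [Finset.mem_Ico] at h
          omega
      · rw [if_neg (by tauto), Finset.sum_eq_zero]
        intro i hi
        rw [Finset.mem_Ico] at hi
        rw [if_neg]
        rintro ⟨_, h⟩
        omega
    · simp [hf]
  rw [e1, wsum_sum]
  refine Finset.sum_congr rfl fun i hi => ?_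
  rw [Finset.mem_Ico] at hi
  have hsh := wsum_shuffle i (s - i - 1) n (i + 1 - k)
    (fun A => if flaws i A = 0 then 1 else 0)
    (fun B => if flaws (n + 1 + k - i - 1) ((l - i - 1) :: B) = 0 then 1 else 0)
  rw [show i + 1 + (s - i - 1) = s by omega] at hsh
  rw [hsh]
  have hp : p (i + 1 - k) i i 0 =
      wsum i (i + 1 - k) (fun A => if flaws i A = 0 then 1 else 0) :=
    card_eq_wsum i (i + 1 - k) (fun T => flaws i T = 0)
  have hN : n + 1 + k - i - 1 = n - (i + 1 - k) + 1 := by omega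
  have hpL : pL (n + 1 + k - i - 1) (n + 1 + k - i - 1) (s - i - 1) 0 (l - i - 1) =
      wsum (s - i - 1) (n - (i + 1 - k))
        (fun B => if flaws (n + 1 + k - i - 1) ((l - i - 1) :: B) = 0 then 1 else 0) := by
    rw [hN, ← wsum_head (s - i - 1) (n - (i + 1 - k)) (l - i - 1) (by omega) (by omega)
      (fun T => flaws (n - (i + 1 - k) + 1) T = 0)]
    exact card_eq_wsum _ _ (fun T => flaws (n - (i + 1 - k) + 1) T = 0 ∧
      T.head? = some (l - i - 1))
  rw [hp, hpL, Nat.add_sub_cancel]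
end

section
/- For every integer k ≥ 0, in the ring of formal power series ℚ[[x]], Σ_{n ≥ 1} (p^1_{n,n+k;≤n+k}/(n−1)!) x^n = x · P(x)^{k+2}. -/
/-- The generating function `P(x) = Σ_{n≥0} (n+1)^{n-1}/n! · xⁿ` of parking functions. -/
noncomputable def Pgf : PowerSeries ℚ :=
  PowerSeries.mk (fun n => (((n + 1) ^ (n - 1) : ℕ) : ℚ) / (Nat.factorial n : ℚ))


theorem parkStep_cases (m : ℕ) (occ : Finset ℕ) (a : ℕ) :
    (parkStep m occ a = occ ∧ Finset.Icc a m ⊆ occ) ∨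
    ∃ j, a ≤ j ∧ j ≤ m ∧ j ∉ occ ∧ (∀ t, a ≤ t → t < j → t ∈ occ) ∧
      parkStep m occ a = insert j occ := by
  unfold parkStep
  split_ifs with h
  · right
    have hm := Finset.min'_mem _ h
    have hmin : ∀ x ∈ Finset.Icc a m \ occ, (Finset.Icc a m \ occ).min' h ≤ x :=
      fun x hx => Finset.min'_le (Finset.Icc a m \ occ) x hx
    generalize (Finset.Icc a m \ occ).min' h = j at *
    simp only [Finset.mem_sdiff, Finset.mem_Icc] at hm hmin
    refine ⟨j, hm.1.1, hm.1.2, hm.2, ?_, rfl⟩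
    intro t h1 h2
    by_contra h3
    have := hmin t ⟨⟨h1, by omega⟩, h3⟩
    omega
  · left
    refine ⟨rfl, ?_⟩
    intro x hx
    by_contra h3
    exact h ⟨x, by simp [h3]; simpa using hx⟩

theorem occupied_append (m : ℕ) (l : List ℕ) (a : ℕ) :
    occupied m (l ++ [a]) = parkStep m (occupied m l) a := by
  simp [occupied]

theorem occupied_inv (m : ℕ) (l : List ℕ) (hl : ∀ a ∈ l, 1 ≤ a) :
    occupied m l ⊆ Finset.Icc 1 m ∧ (occupied m l).card ≤ l.length ∧
    ((occupied m l).card = l.length →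
      ∀ t, l.countP (fun a => t < a) ≤ ((occupied m l).filter (fun x => t < x)).card) ∧
    (∀ t, t ∉ occupied m l →
      ((occupied m l).filter (fun x => t < x)).card ≤ l.countP (fun a => t < a)) := by
  induction l using List.reverseRecOn with
  | nil => simp [occupied]
  | append_singleton l a ih =>
    obtain ⟨h1, h2, h3, h4⟩ := ih (fun b hb => hl b (by simp [hb]))
    have ha : 1 ≤ a := hl a (by simp)
    rw [occupied_append]
    rcases parkStep_cases m (occupied m l) a with ⟨e, hs⟩ | ⟨j, j1, j2, j3, j4, e⟩
    · rw [e]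
      refine ⟨h1, by simp; omega, ?_, ?_⟩
      · intro h
        simp at h
        omega
      · intro t ht
        have := h4 t ht
        rw [List.countP_append]
        omega
    · rw [e]
      refine ⟨?_, ?_, ?_, ?_⟩
      · intro x hx
        rcases Finset.mem_insert.1 hx with rfl | hx
        · simp; omega
        · exact h1 hx
      · rw [Finset.card_insert_of_notMem j3]; simp; omega
      · rw [Finset.card_insert_of_notMem j3]
        intro h t
        simp at h
        have := h3 h t
        rw [List.countP_append, Finset.filter_insert, List.countP_singleton]
        by_cases hj : t < j
        · rw [if_pos hj, Finset.card_insert_of_notMem (by simp [j3])]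
          split_ifs <;> omega
        · have : ¬ t < a := by omega
          simp [hj, this]
          omega
      · intro t ht
        simp only [Finset.mem_insert, not_or] at ht
        have := h4 t ht.2
        rw [List.countP_append, Finset.filter_insert, List.countP_singleton]
        by_cases hj : t < j
        · rw [if_pos hj, Finset.card_insert_of_notMem (by simp [j3])]
          have : t < a := by
            by_contra hh
            exact ht.2 (j4 t (by omega) hj)
          simp [this]; omega
        · simp [hj]; omega

theorem occupied_of_valid (m : ℕ) (l : List ℕ) (hl : ∀ a ∈ l, 1 ≤ a ∧ a ≤ m)
    (hv : ∀ t, l.countP (fun a => t < a) ≤ m - t) : (occupied m l).card = l.length := by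
  induction l using List.reverseRecOn with
  | nil => simp [occupied]
  | append_singleton l a ih =>
    have ih := ih (fun b hb => hl b (by simp [hb])) (fun t => by
      have := hv t
      rw [List.countP_append] at this
      omega)
    obtain ⟨h1, h2, h3, h4⟩ := occupied_inv m l (fun b hb => (hl b (by simp [hb])).1)
    have ha := hl a (by simp)
    rw [occupied_append]
    rcases parkStep_cases m (occupied m l) a with ⟨e, hs⟩ | ⟨j, j1, j2, j3, j4, e⟩
    · exfalso
      set s := (Finset.range a).filter (fun t => t ∉ occupied m l) with hsdef
      have h0 : 0 ∈ s := by
        simp only [hsdef, Finset.mem_filter, Finset.mem_range]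
        refine ⟨by omega, fun h => ?_⟩
        have := h1 h
        simp at this
      have hne : s.Nonempty := ⟨0, h0⟩
      have hm := Finset.max'_mem _ hne
      have hmax : ∀ x ∈ s, x ≤ s.max' hne := fun x hx => Finset.le_max' s x hx
      generalize s.max' hne = t at *
      simp only [hsdef, Finset.mem_filter, Finset.mem_range] at hm hmax
      have hsub : Finset.Ioc t m ⊆ (occupied m l).filter (fun x => t < x) := by
        intro x hx
        simp only [Finset.mem_Ioc] at hx
        simp only [Finset.mem_filter]
        refine ⟨?_, hx.1⟩
        by_cases hxa : a ≤ x
        · exact hs (by simp; omega)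
        · by_contra hh
          have := hmax x ⟨by omega, hh⟩
          omega
      have c1 := Finset.card_le_card hsub
      have c2 := h4 t hm.2
      have c3 := hv t
      rw [List.countP_append, List.countP_singleton] at c3
      simp [hm.1] at c1 c3
      omega
    · rw [e, Finset.card_insert_of_notMem j3]; simp [ih]

theorem flaws_zero_iff_s19 (m : ℕ) (l : List ℕ) (hl : ∀ a ∈ l, 1 ≤ a ∧ a ≤ m) :
    flaws m l = 0 ↔ ∀ t, l.countP (fun a => t < a) ≤ m - t := by
  obtain ⟨h1, h2, h3, h4⟩ := occupied_inv m l (fun b hb => (hl b hb).1)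
  constructor
  · intro h t
    unfold flaws at h
    have := h3 (by omega) t
    refine this.trans ?_
    rw [← Nat.card_Ioc]
    apply Finset.card_le_card
    intro x hx
    simp only [Finset.mem_filter] at hx
    have := h1 hx.1
    simp at this ⊢
    omega
  · intro h
    have := occupied_of_valid m l hl h
    unfold flaws
    omega

theorem prefList_eq {n s : ℕ} (f : Fin n → Fin s) :
    prefList f = List.ofFn (fun i => (f i : ℕ) + 1) := by
  unfold prefList
  apply List.ext_getElem <;> simp [← List.map_eq_flatMap]

theorem card_filter_cons {n : ℕ} (q : Fin (n+1) → Prop) [DecidablePred q] :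
    (Finset.univ.filter q).card =
      (if q 0 then 1 else 0) + (Finset.univ.filter (fun i : Fin n => q i.succ)).card := by
  rw [Fin.card_filter_univ_succ]
  split_ifs <;> simp [add_comm, Function.comp_def]

theorem countP_prefList {n s : ℕ} (f : Fin n → Fin s) (t : ℕ) :
    (prefList f).countP (fun a => t < a) =
      (Finset.univ.filter (fun i => t ≤ (f i : ℕ))).card := by
  rw [prefList_eq]
  induction n with
  | zero => simp
  | succ n ih =>
    rw [List.ofFn_succ, List.countP_cons, ih, card_filter_cons]
    simp only [decide_eq_true_eq, Nat.lt_succ_iff]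
    rw [add_comm]

/-- valid parking preferences, indexed by a finite type -/
def Valid {ι : Type} [Fintype ι] {m : ℕ} (f : ι → Fin m) : Prop :=
  ∀ t : ℕ, (Finset.univ.filter (fun i => t ≤ (f i : ℕ))).card ≤ m - t

theorem flaws_prefList {n m : ℕ} (f : Fin n → Fin m) :
    flaws m (prefList f) = 0 ↔ Valid f := by
  rw [flaws_zero_iff_s19]
  · simp only [countP_prefList]; rfl
  · intro a ha
    simp only [prefList_eq, List.mem_ofFn] at ha
    obtain ⟨i, rfl⟩ := ha
    omega

open Classical in
/-- number of valid preferences -/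
noncomputable def V (ι : Type) [Fintype ι] (m : ℕ) : ℕ :=
  (Finset.univ.filter (fun f : ι → Fin m => Valid f)).card

theorem pL_eq_V (N k : ℕ) : pL (N+1) (N+1+k) (N+1+k) 0 1 = V (Fin N) (N+1+k) := by
  classical
  unfold pL V
  simp only [flaws_prefList]
  have h0 : 0 < N + 1 + k := by omega
  refine Finset.card_nbij' (fun f i => f i.succ) (fun g => Fin.cons ⟨0, h0⟩ g) ?_ ?_ ?_ ?_
  · intro f hf
    simp only [Finset.coe_filter, Finset.mem_univ, true_and, Set.mem_ofPred_eq] at hf ⊢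
    intro t
    refine le_trans ?_ (hf.1 t)
    rw [card_filter_cons (fun i => t ≤ (f i : ℕ))]
    exact Nat.le_add_left _ _
  · intro g hg
    simp only [Finset.coe_filter, Finset.mem_univ, true_and, Set.mem_ofPred_eq] at hg ⊢
    refine ⟨?_, by simp [prefList_eq]⟩
    intro t
    rcases Nat.eq_zero_or_pos t with rfl | ht
    · simp
    · refine le_trans (le_of_eq ?_) (hg t)
      rw [card_filter_cons]
      simp
      omega
  · intro f hf
    simp only [Finset.coe_filter, Finset.mem_univ, true_and, Set.mem_ofPred_eq] at hf
    have h := hf.2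
    simp [prefList_eq] at h
    funext i
    refine Fin.cases ?_ ?_ i
    · simp [Fin.ext_iff, h]
    · simp
  · intro g hg
    funext i
    simp

theorem V_succ (ι : Type) [Fintype ι] (m : ℕ) (h : Fintype.card ι ≤ m + 1) :
    V ι (m+1) = ∑ T ∈ (Finset.univ : Finset ι).powerset, V T m := by
  classical
  conv_lhs => unfold V
  rw [Finset.card_eq_sum_card_fiberwise (f := fun f => Finset.univ.filter (fun i => f i ≠ 0))
    (t := (Finset.univ : Finset ι).powerset) (by intro f _; simp)]
  refine Finset.sum_congr rfl fun T _ => ?_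
  unfold V
  have key : ∀ (f : ι → Fin (m+1)) (g : T → Fin m), (∀ i : T, f i = (g i).succ) →
      ∀ t, (Finset.univ.filter (fun i => t + 1 ≤ (f i : ℕ))).card ≥ (Finset.univ.filter (fun i => t ≤ (g i : ℕ))).card ∧ ((∀ i, i ∉ T → f i = 0) → (Finset.univ.filter (fun i => t + 1 ≤ (f i : ℕ))).card ≤ (Finset.univ.filter (fun i => t ≤ (g i : ℕ))).card) := by
    intro f g hfg t
    constructor
    · refine Finset.card_le_card_of_injOn (fun i => (i : ι)) ?_ (fun _ _ _ _ h => Subtype.ext h)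
      intro i hi
      simp at hi ⊢
      simp [hfg i]
      omega
    · intro h0
      rw [← Finset.card_map (Function.Embedding.subtype (· ∈ T))]
      refine Finset.card_le_card ?_
      intro i hi
      simp only [Finset.mem_filter, Finset.mem_univ, true_and] at hi
      by_cases hT : i ∈ T
      · have := hfg ⟨i, hT⟩
        simp only at this
        rw [this] at hi
        simp [hT]
        simpa using hi
      · rw [h0 i hT] at hi
        simp at hi
  have hne : ∀ {f : ι → Fin (m+1)}, Finset.univ.filter (fun i => f i ≠ 0) = T → ∀ i, f i ≠ 0 ↔ i ∈ T := by
    intro f hf i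
    rw [← hf]; simp
  refine Finset.card_bij' (fun f hf (i : T) => (f i).pred (((hne (Finset.mem_filter.1 hf).2) i).2 i.2))
    (fun g _ i => if h : i ∈ T then (g ⟨i, h⟩).succ else 0) ?_ ?_ ?_ ?_
  · intro f hf
    simp only [Finset.mem_filter, Finset.mem_univ, true_and] at hf ⊢
    intro t
    refine le_trans ((key f _ ?_ t).1) ?_
    · intro i; simp
    · have := hf.1 (t+1); omega
  · intro g hg
    simp only [Finset.mem_filter, Finset.mem_univ, true_and] at hg ⊢
    constructor
    · intro t
      rcases t with _ | t
      · simpa using h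
      · refine le_trans ((key _ g ?_ t).2 ?_) ?_
        · intro i; simp
        · intro i hi; simp [hi]
        · have := hg t; omega
    · ext i
      by_cases hi : i ∈ T <;> simp [hi]
  · intro f hf
    funext i
    by_cases hi : i ∈ T
    · simp [hi]
    · have := (hne (Finset.mem_filter.1 hf).2 i).not.2 hi
      simp [hi]
      simpa [eq_comm] using this
  · intro g hg
    funext i
    simp

theorem sum_aux (N : ℕ) (M : ℚ) :
    (M + 1) * ∑ i ∈ Finset.range (N+1), (N.choose i : ℚ) * ((M - i) * M ^ i) =
      M * (M + 1 - N) * (M+1)^N := by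
  have e1 : ∀ n : ℕ, ∑ i ∈ Finset.range (n+1), (n.choose i : ℚ) * M ^ i = (M+1)^n := by
    intro n
    rw [add_pow]
    exact Finset.sum_congr rfl fun i _ => by simp [mul_comm]
  have e2 : (M+1) * ∑ i ∈ Finset.range (N+1), (N.choose i : ℚ) * (i * M ^ i) = N * M * (M+1)^N := by
    rcases N with _ | n
    · simp
    · rw [Finset.sum_range_succ', pow_succ, ← e1 n]
      simp only [Nat.cast_zero, zero_mul, mul_zero, add_zero]
      simp only [Finset.mul_sum, Finset.sum_mul]
      refine Finset.sum_congr rfl fun i _ => ?_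
      have h : ((n + 1 : ℕ) : ℚ) * (n.choose i : ℚ) = ((n+1).choose (i+1) : ℚ) * ((i + 1 : ℕ) : ℚ) := by
        exact_mod_cast Nat.add_one_mul_choose_eq n i
      linear_combination (-(M+1) * M^(i+1)) * h
  have e3 : ∑ i ∈ Finset.range (N+1), (N.choose i : ℚ) * ((M - i) * M ^ i) =
      M * ∑ i ∈ Finset.range (N+1), (N.choose i : ℚ) * M ^ i
      - ∑ i ∈ Finset.range (N+1), (N.choose i : ℚ) * (i * M ^ i) := by
    rw [Finset.mul_sum, ← Finset.sum_sub_distrib]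
    exact Finset.sum_congr rfl fun i _ => by ring
  rw [e3, mul_sub, e2, e1]
  ring

theorem V_formula (m : ℕ) : ∀ (ι : Type) [Fintype ι], Fintype.card ι ≤ m + 1 →
    ((m : ℚ) + 1) * (V ι m : ℚ) = ((m : ℚ) + 1 - Fintype.card ι) * ((m : ℚ) + 1) ^ Fintype.card ι := by
  induction m with
  | zero =>
    intro ι _ h
    classical
    by_cases h0 : Fintype.card ι = 0
    · have := Fintype.card_eq_zero_iff.1 h0
      simp [V, Valid]
    · have h1 : Fintype.card ι = 1 := by omega
      have : Nonempty ι := Fintype.card_pos_iff.1 (by omega)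
      simp [V, h1]
  | succ m ih =>
    intro ι _ h
    classical
    by_cases hc : Fintype.card ι = m + 2
    · have : V ι (m+1) = 0 := by
        unfold V
        rw [Finset.card_eq_zero, Finset.filter_eq_empty_iff]
        intro f _ hf
        have := hf 0
        simp at this
        omega
      rw [this, hc]; push_cast; ring
    · rw [V_succ ι m (by omega)]
      have hm : ((m:ℚ) + 1) ≠ 0 := by positivity
      apply mul_left_cancel₀ hm
      have h2 : ((m:ℚ)+1) * ((∑ T ∈ (Finset.univ : Finset ι).powerset, V T m : ℕ) : ℚ) =
          ∑ i ∈ Finset.range (Fintype.card ι + 1), ((Fintype.card ι).choose i : ℚ) * ((((m:ℚ)+1) - i) * ((m:ℚ)+1) ^ i) := by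
        push_cast
        rw [Finset.mul_sum]
        trans ∑ T ∈ (Finset.univ : Finset ι).powerset, ((((m:ℚ)+1) - (T.card:ℚ)) * ((m:ℚ)+1) ^ T.card)
        · refine Finset.sum_congr rfl fun T _ => ?_
          have := ih T (by
            have := Finset.card_le_univ T
            simp only [Fintype.card_coe]; omega)
          simpa using this
        · rw [Finset.sum_powerset_apply_card (fun i : ℕ => ((((m:ℚ)+1) - (i:ℚ)) * ((m:ℚ)+1) ^ i))]
          simp [nsmul_eq_mul]
      have h3 := sum_aux (Fintype.card ι) ((m:ℚ)+1)
      rw [← h2] at h3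
      push_cast at h3 ⊢
      linear_combination h3

open Polynomial in
/-- normalised Abel polynomials -/
noncomputable def abelPoly : ℕ → ℚ[X]
  | 0 => 1
  | (n+1) => C (1 / ((n+1).factorial : ℚ)) * (X * (X + C ((n:ℚ)+1)) ^ n)

open Polynomial in
theorem abelPoly_deriv (n : ℕ) :
    derivative (abelPoly (n+1)) = (abelPoly n).comp (X + 1) := by
  rcases n with _ | n
  · simp [abelPoly]
  · have hf : (C (1 / ((n+1).factorial : ℚ)) : ℚ[X]) = C (1 / ((n+2).factorial : ℚ)) * C ((n:ℚ) + 2) := by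
      rw [← C_mul]
      congr 1
      rw [Nat.factorial_succ (n+1)]
      push_cast
      field_simp
      ring
    have e : ((n + 1 : ℕ) : ℚ) = (n:ℚ) + 1 := by push_cast; ring
    simp only [abelPoly]
    rw [hf]
    simp only [derivative_mul, derivative_C, derivative_X, derivative_pow, derivative_add, mul_comp, C_comp, X_comp, pow_comp, add_comp, Nat.add_sub_cancel]
    simp only [C_add, e, C_1]
    have : (C (2:ℚ)) = (2 : ℚ[X]) := rfl
    rw [this]
    ring

open Polynomial in
theorem abel_conv (a : ℚ) (n : ℕ) :
    ∑ ij ∈ Finset.HasAntidiagonal.antidiagonal n, C ((abelPoly ij.1).eval a) * abelPoly ij.2 =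
      (abelPoly n).comp (X + C a) := by
  induction n with
  | zero => simp [abelPoly]
  | succ n ih =>
    have hz : ∀ p q : ℚ[X], derivative p = derivative q → p.eval 0 = q.eval 0 → p = q := by
      intro p q h1 h2
      have h3 : derivative (p - q) = 0 := by simp [h1]
      have h4 := Polynomial.derivative_eq_zero.1 h3
      obtain ⟨c, hc⟩ := natDegree_eq_zero.1 h4
      have h5 : (p - q).eval 0 = 0 := by simp [h2]
      rw [← hc] at h5
      simp at h5
      rw [h5] at hc
      simp at hc
      exact sub_eq_zero.1 hc.symm
    apply hz
    · rw [derivative_comp, abelPoly_deriv, Finset.Nat.antidiagonal_succ']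
      simp only [Finset.sum_cons, Finset.sum_map, derivative_add, derivative_sum, derivative_mul, derivative_C]
      simp only [Function.Embedding.prodMap, Function.Embedding.coeFn_mk, Prod.map, Function.Embedding.refl_apply, Nat.succ_eq_add_one, abelPoly_deriv]
      have := congrArg (compRingHom (X + 1)) ih
      simp only [map_sum, coe_compRingHom_apply, mul_comp, C_comp] at this
      simp only [show abelPoly 0 = 1 from rfl, derivative_one, derivative_X, zero_mul, mul_zero, zero_add, add_zero, mul_one, one_mul, this]
      rw [comp_assoc, comp_assoc]
      congr 1
      simp
      ring
    · rw [Finset.Nat.antidiagonal_succ']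
      simp [eval_finsetSum, abelPoly]

theorem Pgf_pow (r : ℕ) : Pgf ^ r = PowerSeries.mk (fun n => (abelPoly n).eval (r:ℚ)) := by
  induction r with
  | zero =>
    ext n
    rcases n with _ | n <;> simp [abelPoly, PowerSeries.coeff_one]
  | succ r ih =>
    have hP : Pgf = PowerSeries.mk (fun n => (abelPoly n).eval (1:ℚ)) := by
      ext n
      rcases n with _ | n
      · simp [Pgf, abelPoly]
      · simp [Pgf, abelPoly]
        ring
    rw [pow_succ, ih]
    conv_lhs => rw [hP]
    ext n
    rw [PowerSeries.coeff_mul]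
    simp only [PowerSeries.coeff_mk]
    have := congrArg (Polynomial.eval 1) (abel_conv r n)
    simp only [Polynomial.eval_finsetSum, Polynomial.eval_mul, Polynomial.eval_C, Polynomial.eval_comp, Polynomial.eval_add, Polynomial.eval_X] at this
    rw [this]
    push_cast
    rw [add_comm]

/-- Lemma 7.4: for `k ≥ 0`, in `ℚ[[x]]`,
`Σ_{n≥1} p^1_{n,n+k;≤n+k}/(n-1)! · xⁿ = x · P(x)^{k+2}`. -/
theorem stmt19 (k : ℕ) :
    PowerSeries.mk (fun n =>
        if 1 ≤ n then (pL n (n + k) (n + k) 0 1 : ℚ) / (Nat.factorial (n - 1) : ℚ) else 0) =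
      PowerSeries.X * Pgf ^ (k + 2) := by
  ext n
  rcases n with _ | N
  · simp
  · rw [PowerSeries.coeff_succ_X_mul, Pgf_pow]
    simp only [PowerSeries.coeff_mk]
    rw [if_pos (by omega), pL_eq_V]
    have h := V_formula (N+1+k) (Fin N) (by simp; omega)
    have hne : (((N + 1 + k : ℕ) : ℚ) + 1) ≠ 0 := by positivity
    apply mul_left_cancel₀ hne
    rw [← mul_div_assoc, h]
    rcases N with _ | N
    · simp [abelPoly]
    · simp [abelPoly]
      field_simp
      ring
end
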